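/- The maximum spanning tree routing function satisfies robustness, scale invariance, and shift invariance, but there exists a connected weighted graph G with pairwise distinct edge weights and a destination d such that the unique maximum spanning tree of G is not a minimum spanning tree of G. Precisely: (i) if G−e is connected and a vertex v's unique path to d in the unique maximum spanning tree of G avoids e, that path is unchanged in the unique maximum spanning tree of G−e; (ii) for α>0 the unique maximum spanning tree of (V,E,α·W) equals that of (V,E,W); (iii) for α∈ℝ the unique maximum spanning tree of (V,E,W+α) equals that of (V,E,W); and (iv) there is a connected weighted graph with distinct weights whose unique maximum spanning tree differs from its unique minimum spanning tree. -/

import Mathlib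

open SimpleGraph

/-- The total weight of (the edges of) a graph. -/
noncomputable def treeWeight {V : Type*} (T : SimpleGraph V) (W : Sym2 V → ℝ) : ℝ :=
  ∑ᶠ e ∈ T.edgeSet, W e

/-- `T` is a minimum spanning tree of the weighted graph `(G, W)`. -/
def IsMST {V : Type*} (G : SimpleGraph V) (W : Sym2 V → ℝ) (T : SimpleGraph V) : Prop :=
  T ≤ G ∧ T.IsTree ∧
    ∀ T' : SimpleGraph V, T' ≤ G → T'.IsTree → treeWeight T W ≤ treeWeight T' W

/-- `T` is a maximum spanning tree of the weighted graph `(G, W)`. -/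
def IsMaxST {V : Type*} (G : SimpleGraph V) (W : Sym2 V → ℝ) (T : SimpleGraph V) : Prop :=
  T ≤ G ∧ T.IsTree ∧
    ∀ T' : SimpleGraph V, T' ≤ G → T'.IsTree → treeWeight T' W ≤ treeWeight T W

theorem SimpleGraph.Connected.reachable_deleteEdges_or {V : Type*} {G : SimpleGraph V}
    (hG : G.Connected) (x y v : V) :
    (G.deleteEdges {s(x, y)}).Reachable v x ∨ (G.deleteEdges {s(x, y)}).Reachable v y := by
  suffices ∀ {u w : V}, G.Walk u w →
      ((G.deleteEdges {s(x, y)}).Reachable w x ∨ (G.deleteEdges {s(x, y)}).Reachable w y) →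
      (G.deleteEdges {s(x, y)}).Reachable u x ∨ (G.deleteEdges {s(x, y)}).Reachable u y from
    this (hG v x).some (.inl .rfl)
  intro u w p hw
  induction p with
  | nil => exact hw
  | @cons u u' w hadj p ih =>
    by_cases h : s(u, u') = s(x, y)
    · rcases Sym2.eq_iff.1 h with ⟨rfl, -⟩ | ⟨rfl, -⟩
      · exact .inl .rfl
      · exact .inr .rfl
    · have hr : (G.deleteEdges {s(x, y)}).Reachable u u' :=
        Adj.reachable (by simpa [deleteEdges_adj, hadj] using h)
      exact (ih hw).imp hr.trans hr.trans

/-- Replacing an edge of a tree by one joining the two resulting components gives a tree. -/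
theorem SimpleGraph.IsTree.deleteEdges_sup_edge {V : Type*} {T : SimpleGraph V} (hT : T.IsTree)
    {g : Sym2 V} {a b : V} (hab : ¬ (T.deleteEdges {g}).Reachable a b) :
    (T.deleteEdges {g} ⊔ edge a b).IsTree := by
  have : Nonempty V := ⟨a⟩
  refine ⟨⟨?_⟩, (hT.isAcyclic.anti (deleteEdges_le _)).sup_edge_of_not_reachable hab⟩
  induction g with | _ x y
  have hle : T.deleteEdges {s(x, y)} ≤ T.deleteEdges {s(x, y)} ⊔ edge a b := le_sup_left
  have hne : a ≠ b := by rintro rfl; exact hab .rfl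
  have hadj : (T.deleteEdges {s(x, y)} ⊔ edge a b).Reachable a b :=
    Adj.reachable (.inr (by simp [edge_adj, hne]))
  have hor := hT.connected.reachable_deleteEdges_or x y
  have hxy : (T.deleteEdges {s(x, y)} ⊔ edge a b).Reachable x y := by
    rcases hor a with ha | ha <;> rcases hor b with hb | hb
    · exact absurd (ha.trans hb.symm) hab
    · exact ((ha.mono hle).symm.trans hadj).trans (hb.mono hle)
    · exact (((ha.mono hle).symm.trans hadj).trans (hb.mono hle)).symm
    · exact absurd (ha.trans hb.symm) hab
  have hx (v : V) : (T.deleteEdges {s(x, y)} ⊔ edge a b).Reachable v x :=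
    (hor v).elim (·.mono hle) fun h ↦ (h.mono hle).trans hxy.symm
  exact fun u v ↦ (hx u).trans (hx v).symm

theorem treeWeight_deleteEdges_sup_edge {V : Type*} [Finite V] {T : SimpleGraph V}
    (W : Sym2 V → ℝ) {g : Sym2 V} (hg : g ∈ T.edgeSet) {a b : V}
    (hab : ¬ (T.deleteEdges {g}).Reachable a b) :
    treeWeight (T.deleteEdges {g} ⊔ edge a b) W + W g = treeWeight T W + W s(a, b) := by
  have hne : a ≠ b := by rintro rfl; exact hab .rfl
  have hnot : s(a, b) ∉ T.edgeSet \ {g} := by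
    rw [← edgeSet_deleteEdges]
    exact fun h ↦ hab (Adj.reachable h)
  have hE : (T.deleteEdges {g} ⊔ edge a b).edgeSet = insert s(a, b) (T.edgeSet \ {g}) := by
    rw [edgeSet_sup, edgeSet_edge_of_ne hne, edgeSet_deleteEdges, Set.union_singleton]
  have hT : treeWeight T W = W g + ∑ᶠ e ∈ T.edgeSet \ {g}, W e := by
    rw [treeWeight, ← finsum_mem_insert W (by simp) (Set.toFinite _),
      Set.insert_sdiff_singleton, Set.insert_eq_of_mem hg]
  rw [hT, treeWeight, hE, finsum_mem_insert W hnot (Set.toFinite _)]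
  ring

theorem IsMaxST.weight_le {V : Type*} [Finite V] {G T : SimpleGraph V} {W : Sym2 V → ℝ}
    (hT : IsMaxST G W T) {g : Sym2 V} (hg : g ∈ T.edgeSet) {a b : V} (hG : G.Adj a b)
    (hab : ¬ (T.deleteEdges {g}).Reachable a b) : W s(a, b) ≤ W g := by
  have hle : T.deleteEdges {g} ⊔ edge a b ≤ G :=
    sup_le ((deleteEdges_le _).trans hT.1) ((edge_le_iff G).2 (.inr hG))
  have h₁ := hT.2.2 _ hle (hT.2.1.deleteEdges_sup_edge hab)
  have h₂ := treeWeight_deleteEdges_sup_edge W hg hab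
  linarith

/-- An edge of the maximum spanning tree of `G` that survives in a subgraph `H` belongs to the
maximum spanning tree of `H`. -/
theorem IsMaxST.mem_edgeSet_of_le {V : Type*} [Finite V] {G H T T' : SimpleGraph V}
    {W : Sym2 V → ℝ} (hW : Set.InjOn W G.edgeSet) (hHG : H ≤ G) (hT : IsMaxST G W T)
    (hT' : IsMaxST H W T') {g : Sym2 V} (hg : g ∈ T.edgeSet) (hgH : g ∈ H.edgeSet) :
    g ∈ T'.edgeSet := by
  by_contra hgT'
  induction g with | _ a b
  have hbridge : ¬ (T.deleteEdges {s(a, b)}).Reachable a b :=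
    isAcyclic_iff_forall_isBridge.1 hT.2.1.isAcyclic hg
  obtain ⟨p, hp⟩ := hT'.2.1.connected.exists_isPath a b
  obtain ⟨⟨⟨x, y⟩, hxy⟩, hd, hx, hy⟩ :=
    p.exists_boundary_dart {v | (T.deleteEdges {s(a, b)}).Reachable a v} .rfl hbridge
  have hxyp : s(x, y) ∈ p.edges := List.mem_map.2 ⟨_, hd, rfl⟩
  have h₁ : W s(x, y) ≤ W s(a, b) :=
    hT.weight_le hg (hHG (hT'.1 hxy)) fun h ↦ hy (Reachable.trans hx h)
  have h₂ : W s(a, b) ≤ W s(x, y) := by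
    refine hT'.weight_le (T'.mem_edgeSet.2 hxy) hgH fun h ↦ ?_
    obtain ⟨q, hq⟩ := h.exists_isPath
    have hpq := congrArg Subtype.val <| (hT'.2.1.isAcyclic.subsingleton_path a b).elim ⟨p, hp⟩
      ⟨q.mapLe (deleteEdges_le _), hq.mapLe _⟩
    subst hpq
    rw [Walk.edges_mapLe_eq_edges] at hxyp
    simpa using q.edges_subset_edgeSet hxyp
  have h := hW (hT.1 hg) (hHG (hT'.1 hxy)) (le_antisymm h₂ h₁)
  exact hgT' (h ▸ hxy)

theorem IsMaxST.unique {V : Type*} [Finite V] {G T T' : SimpleGraph V} {W : Sym2 V → ℝ}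
    (hW : Set.InjOn W G.edgeSet) (hT : IsMaxST G W T) (hT' : IsMaxST G W T') : T = T' :=
  edgeSet_injective <| Set.Subset.antisymm
    (fun _ h ↦ hT.mem_edgeSet_of_le hW le_rfl hT' h (edgeSet_mono hT.1 h))
    (fun _ h ↦ hT'.mem_edgeSet_of_le hW le_rfl hT h (edgeSet_mono hT'.1 h))

theorem treeWeight_const_mul {V : Type*} (T : SimpleGraph V) (W : Sym2 V → ℝ) (α : ℝ) :
    treeWeight T (fun e ↦ α * W e) = α * treeWeight T W :=
  (mul_finsum_mem _ _).symm

theorem SimpleGraph.IsTree.treeWeight_add_const {V : Type*} [Finite V] {T : SimpleGraph V}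
    (hT : T.IsTree) (W : Sym2 V → ℝ) (α : ℝ) :
    treeWeight T (fun e ↦ W e + α) = treeWeight T W + (Nat.card V - 1) * α := by
  have hcard : (Nat.card T.edgeSet : ℝ) + 1 = Nat.card V := by
    exact_mod_cast (isTree_iff_connected_and_card.1 hT).2
  have hc : ∑ᶠ e ∈ T.edgeSet, α = Nat.card T.edgeSet * α := by
    rw [finsum_mem_eq_finite_toFinset_sum _ (Set.toFinite _), Finset.sum_const, nsmul_eq_mul,
      ← Set.ncard_eq_toFinset_card, Nat.card_coe_set_eq]
  rw [treeWeight, finsum_mem_add_distrib (Set.toFinite _), hc, treeWeight, ← hcard]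
  ring

theorem IsMaxST.of_const_mul {V : Type*} {G T : SimpleGraph V} {W : Sym2 V → ℝ} {α : ℝ}
    (hα : 0 < α) (hT : IsMaxST G (fun e ↦ α * W e) T) : IsMaxST G W T :=
  ⟨hT.1, hT.2.1, fun S hS hS' ↦ by
    simpa only [treeWeight_const_mul, mul_le_mul_iff_right₀ hα] using hT.2.2 S hS hS'⟩

theorem IsMaxST.of_add_const {V : Type*} [Finite V] {G T : SimpleGraph V} {W : Sym2 V → ℝ} {α : ℝ}
    (hT : IsMaxST G (fun e ↦ W e + α) T) : IsMaxST G W T :=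
  ⟨hT.1, hT.2.1, fun S hS hS' ↦ by
    simpa only [hS'.treeWeight_add_const, hT.2.1.treeWeight_add_const, add_le_add_iff_right]
      using hT.2.2 S hS hS'⟩

/-- A spanning tree that is both maximum and minimum is the only spanning tree. -/
theorem IsMaxST.eq_of_isMST {V : Type*} [Finite V] {G T S : SimpleGraph V} {W : Sym2 V → ℝ}
    (hW : Set.InjOn W G.edgeSet) (hT : IsMaxST G W T) (hT' : IsMST G W T) (hSG : S ≤ G)
    (hS : S.IsTree) : S = T :=
  IsMaxST.unique hW ⟨hSG, hS, fun S' h h' ↦ (hT.2.2 S' h h').trans (hT'.2.2 S hSG hS)⟩ hT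

/-- maximum spanning tree routing is (i) robust, (ii) scale invariant and
(iii) shift invariant, but (iv) there is a connected weighted graph with pairwise
distinct weights (and a destination) whose unique maximum spanning tree differs from its
unique minimum spanning tree. -/
theorem max_spanning_tree_properties {V : Type*} [Fintype V] [DecidableEq V] :
    -- (i) robustness
    (∀ (G : SimpleGraph V) (W : Sym2 V → ℝ) (d : V) (e : Sym2 V),
      G.Connected → Set.InjOn W G.edgeSet → e ∈ G.edgeSet →
      (G.deleteEdges {e}).Connected →
      ∀ T T' : SimpleGraph V, IsMaxST G W T → IsMaxST (G.deleteEdges {e}) W T' →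
        ∀ (v : V) (p : T.Walk v d), p.IsPath → e ∉ p.edges →
          ∃ q : T'.Walk v d, q.IsPath ∧ q.edges = p.edges) ∧
    -- (ii) scale invariance
    (∀ (G : SimpleGraph V) (W : Sym2 V → ℝ) (α : ℝ), 0 < α →
      G.Connected → Set.InjOn W G.edgeSet →
      ∀ T T' : SimpleGraph V, IsMaxST G W T → IsMaxST G (fun e => α * W e) T' →
        T' = T) ∧
    -- (iii) shift invariance
    (∀ (G : SimpleGraph V) (W : Sym2 V → ℝ) (α : ℝ),
      G.Connected → Set.InjOn W G.edgeSet →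
      ∀ T T' : SimpleGraph V, IsMaxST G W T → IsMaxST G (fun e => W e + α) T' →
        T' = T) ∧
    -- (iv) the maximum spanning tree is in general not a minimum spanning tree
    (∃ (n : ℕ) (G : SimpleGraph (Fin n)) (W : Sym2 (Fin n) → ℝ) (_ : Fin n),
      G.Connected ∧ Set.InjOn W G.edgeSet ∧
      ∀ T T' : SimpleGraph (Fin n), IsMaxST G W T → IsMST G W T' → T ≠ T') := by
  refine ⟨fun G W d e _ hW _ _ T T' hT hT' v p hp he ↦ ?_,
    fun G W α hα _ hW T T' hT hT' ↦ hT'.of_const_mul hα |>.unique hW hT,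
    fun G W α _ hW T T' hT hT' ↦ hT'.of_add_const.unique hW hT, ?_⟩
  · have hmem : ∀ f ∈ p.edges, f ∈ T'.edgeSet := fun f hf ↦ by
      have hfT := p.edges_subset_edgeSet hf
      refine hT.mem_edgeSet_of_le hW (deleteEdges_le _) hT' hfT ?_
      rw [edgeSet_deleteEdges]
      exact ⟨edgeSet_mono hT.1 hfT, fun h ↦ he (h ▸ hf)⟩
    exact ⟨p.transfer T' hmem, hp.transfer hmem, p.edges_transfer hmem⟩
  · have hW : Function.Injective fun e : Sym2 (Fin 3) ↦ ((Fintype.equivFin _ e : ℕ) : ℝ) :=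
      Nat.cast_injective.comp (Fin.val_injective.comp (Equiv.injective _))
    refine ⟨3, ⊤, _, 0, connected_top, hW.injOn, ?_⟩
    rintro T _ hT hT' rfl
    have h := (hT.eq_of_isMST hW.injOn hT' le_top (isTree_starGraph 0)).trans
      (hT.eq_of_isMST hW.injOn hT' le_top (isTree_starGraph 1)).symm
    have h₂ : (starGraph (1 : Fin 3)).Adj 0 2 := h ▸ starGraph_center_adj (by decide)
    simp at h₂
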